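/- arXiv:2604.04378 — 2 statements merged into one kernel-verified Lean document; each statement's English description precedes it below -/
import Mathlib

section
/- For n = 2, the trace of the Lax matrix L = N·B·C^{-1} equals (1-Q₁)z₁ + (1-Q₂)z₂ + (1-Q₁)z₂^{-1} + z₁^{-1}. -/
open Matrix

/-- For `n = 2`, the trace of the Lax matrix `L = N B C⁻¹` equals
`(1-Q₁)z₁ + (1-Q₂)z₂ + (1-Q₁)z₂⁻¹ + z₁⁻¹`. -/
theorem lax_matrix_n2_trace (z₁ z₂ Q₁ Q₂ : ℝ) (hz₁ : z₁ ≠ 0) (hz₂ : z₂ ≠ 0) :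
    let N : Matrix (Fin 4) (Fin 4) ℝ :=
      !![z₁, 1, 0, 0; 0, z₂, 0, 0; 0, 0, 1, Q₁ * z₁; 0, 0, 0, 1]
    let B : Matrix (Fin 4) (Fin 4) ℝ :=
      !![1, 0, 0, 1; 0, 1, 1, 0; 0, 0, 1, 0; 0, 0, 0, 1]
    let C : Matrix (Fin 4) (Fin 4) ℝ :=
      !![1, 0, 0, 0; Q₁ * z₁, 1, 0, 0; 0, Q₂ * z₂, z₂, 0; 0, 0, 1, z₁]
    Matrix.trace (N * B * C⁻¹) =
      (1 - Q₁) * z₁ + (1 - Q₂) * z₂ + (1 - Q₁) * z₂⁻¹ + z₁⁻¹ := by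
  intro N B C
  have hC : C * !![1, 0, 0, 0; -(Q₁ * z₁), 1, 0, 0; Q₁ * Q₂ * z₁, -Q₂, z₂⁻¹, 0;
      -(Q₁ * Q₂), Q₂ * z₁⁻¹, -(z₁⁻¹ * z₂⁻¹), z₁⁻¹] = 1 := by
    ext i j
    fin_cases i <;> fin_cases j <;>
      simp [C, Matrix.mul_apply, Fin.sum_univ_four] <;> field_simp <;> ring
  rw [Matrix.inv_eq_right_inv hC]
  simp [N, B, Matrix.trace, Fin.sum_univ_four]
  field_simp
  ring
end

section
/- For n = 2, the matrix C = [[J N₂₂ J, 0],[P, J N₁₁ J]] factors as C = K·R^{-1}, where, writing a_i = Q_i z_i, b_i = z_i, M₁ = 1 − a₁/b₂: K = [[K₁₁, 0],[K₁₂, J K₁₁ J]] with K₁₁ = [[b₁/M₁, 1],[a₁b₁/M₁, b₂]] and K₁₂ = M₁ a₂ b₂ · E_{1,2}, and R = blockdiag(R₁₁, R₂₂) with R₁₁ = [[b₁/M₁, 1],[0, M₁ b₂]] and R₂₂ = [[1, a₁b₁/(M₁ b₂)],[0, 1]]. -/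
open Matrix

/-- For `n = 2`, the matrix `C = [[J N₂₂ J, 0],[P, J N₁₁ J]]` factors as `C = K · R⁻¹`
with `K ∈ G₋` and `R ∈ G₊` given by the explicit formulas (here `a_i = Q_i z_i`,
`b_i = z_i`, `M₁ = 1 − a₁/b₂`). -/
theorem C_factorization_n2 {F : Type*} [Field F]
    (z₁ z₂ Q₁ Q₂ : F) (hz₁ : z₁ ≠ 0) (hz₂ : z₂ ≠ 0)
    (hM₁ : (1 : F) - Q₁ * z₁ / z₂ ≠ 0) :
    let a₁ : F := Q₁ * z₁
    let a₂ : F := Q₂ * z₂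
    let b₁ : F := z₁
    let b₂ : F := z₂
    let M₁ : F := 1 - a₁ / b₂
    let C : Matrix (Fin 4) (Fin 4) F :=
      !![1, 0, 0, 0; Q₁ * z₁, 1, 0, 0; 0, Q₂ * z₂, z₂, 0; 0, 0, 1, z₁]
    let K : Matrix (Fin 4) (Fin 4) F :=
      !![b₁ / M₁, 1, 0, 0;
         a₁ * b₁ / M₁, b₂, 0, 0;
         0, M₁ * a₂ * b₂, b₂, a₁ * b₁ / M₁;
         0, 0, 1, b₁ / M₁]
    let R : Matrix (Fin 4) (Fin 4) F :=
      !![b₁ / M₁, 1, 0, 0;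
         0, M₁ * b₂, 0, 0;
         0, 0, 1, a₁ * b₁ / (M₁ * b₂);
         0, 0, 0, 1]
    C = K * R⁻¹ := by
  intro a₁ a₂ b₁ b₂ M₁ C K R
  have hM : M₁ ≠ 0 := hM₁
  have hM_mul : M₁ * z₂ = z₂ - Q₁ * z₁ := by
    simp only [M₁, a₁, b₂]
    field_simp
  have hdet : IsUnit R.det := by
    have hR : R.IsUpperTriangular := by
      intro i j hij
      fin_cases i <;> fin_cases j <;> simp_all [R]
    rw [det_of_isUpperTriangular hR, isUnit_iff_ne_zero]
    simp [Fin.prod_univ_four, R, b₁, b₂, hM, hz₁, hz₂]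
  have hCR : C * R = K := by
    simp only [C, R, K, a₁, a₂, b₁, b₂]
    clear_value M₁
    ext i j
    fin_cases i <;> fin_cases j <;>
      simp [Matrix.mul_apply, Fin.sum_univ_four] <;> field_simp <;>
      linear_combination hM_mul
  rw [← hCR, mul_nonsing_inv_cancel_right _ _ hdet]
end
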